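/- Let m ≥ 1 be an integer and define s(t) = (1/(2m+1)!) · ∑_{i=2m+1}^{3m} ( (i!)² (−1)^{i+m} / ( ((i−2m−1)!)² (3m−i)! (i+m)! ) ) · ( 1/(t−i) − 1/(t−2m+i) ) for real t outside {2m+1,…,3m} ∪ {−m,…,−1}. Then s(0) < 0 and s(1) < 0. -/

import Mathlib

open Finset

/-- The rational function `s(t)` from the proof of Proposition `interp-2`. -/
noncomputable def sfun (m : ℕ) (t : ℝ) : ℝ :=
  (1 / (Nat.factorial (2 * m + 1) : ℝ)) *
    ∑ i ∈ Finset.Icc (2 * m + 1) (3 * m),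
      ((Nat.factorial i : ℝ) ^ 2 * (-1 : ℝ) ^ (i + m)
        / ((Nat.factorial (i - (2 * m + 1)) : ℝ) ^ 2
            * (Nat.factorial (3 * m - i) : ℝ) * (Nat.factorial (i + m) : ℝ)))
      * (1 / (t - (i : ℝ)) - 1 / (t - 2 * m + (i : ℝ)))

open Polynomial in
/-- If `P` is monic of degree `#s`, its Lagrange data at `#s` nodes `x i` gives the partial fraction
expansion of `1 - P / nodal` away from the nodes. -/
lemma sum_nodalWeight_mul_eval_div {ι : Type*} [DecidableEq ι] (s : Finset ι) (x : ι → ℝ)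
    (hx : Set.InjOn x s) (P : ℝ[X]) (hP : P.Monic) (hdeg : P.natDegree = #s)
    (z : ℝ) (hz : ∀ i ∈ s, z ≠ x i) :
    ∑ i ∈ s, Lagrange.nodalWeight s x i * P.eval (x i) / (x i - z)
      = 1 - P.eval z / (Lagrange.nodal s x).eval z := by
  have hN : (Lagrange.nodal s x).eval z ≠ 0 := by
    rw [Lagrange.eval_nodal]
    exact Finset.prod_ne_zero_iff.2 fun i hi => sub_ne_zero.2 (hz i hi)
  have hPdeg : P.degree = #s := by
    rw [degree_eq_natDegree hP.ne_zero, hdeg]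
  have hlt : (P - Lagrange.nodal s x).degree < #s := by
    rw [← hPdeg]
    exact degree_sub_lt_left (by rw [hPdeg, Lagrange.degree_nodal]) hP.ne_zero
      (by rw [hP.leadingCoeff, Lagrange.nodal_monic.leadingCoeff])
  have hint : P - Lagrange.nodal s x = Lagrange.interpolate s x fun i => P.eval (x i) := by
    refine Lagrange.eq_interpolate_of_eval_eq _ hx hlt fun i hi => ?_
    rw [eval_sub, Lagrange.eval_nodal_at_node hi, sub_zero]
  have hev := congrArg (eval z) hint
  rw [Lagrange.eval_interpolate_not_at_node _ hz, eval_sub] at hev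
  have hsum : ∑ i ∈ s, Lagrange.nodalWeight s x i * P.eval (x i) / (x i - z)
      = -∑ i ∈ s, Lagrange.nodalWeight s x i * (z - x i)⁻¹ * P.eval (x i) := by
    rw [← Finset.sum_neg_distrib]
    refine Finset.sum_congr rfl fun i _ => ?_
    rw [← neg_sub z (x i), div_neg, div_eq_mul_inv]
    ring
  rw [hsum, eq_sub_iff_add_eq, ← eq_sub_iff_add_eq', div_eq_iff hN]
  linear_combination hev

lemma integrable_inv_sq_add_sq {y : ℝ} (hy : 0 < y) :
    MeasureTheory.Integrable fun u : ℝ => (y ^ 2 + u ^ 2)⁻¹ := by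
  have h := (integrable_inv_one_add_sq.comp_div hy.ne').const_mul (y ^ 2)⁻¹
  refine h.congr (Filter.Eventually.of_forall fun u => ?_)
  simp only
  rw [← mul_inv]
  congr 1
  field_simp

lemma integral_univ_inv_sq_add_sq {y : ℝ} (hy : 0 < y) :
    ∫ u : ℝ, (y ^ 2 + u ^ 2)⁻¹ = Real.pi / y := by
  have h : ∀ u : ℝ, (y ^ 2 + u ^ 2)⁻¹ = (y ^ 2)⁻¹ * (1 + (u / y) ^ 2)⁻¹ := fun u => by
    rw [← mul_inv]
    congr 1
    field_simp
  simp_rw [h]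
  rw [MeasureTheory.integral_const_mul,
    MeasureTheory.Measure.integral_comp_div (fun u : ℝ => (1 + u ^ 2)⁻¹) y,
    integral_univ_inv_one_add_sq, abs_of_pos hy, smul_eq_mul]
  field_simp

open Polynomial in
/-- Positivity of the divided difference of `P(w) / √w` at the nodes `w = (y i) ^ 2`, obtained from
`π / y = ∫ (y ^ 2 + u ^ 2)⁻¹ du`. -/
lemma sum_nodalWeight_mul_eval_div_pos {ι : Type*} [DecidableEq ι] (s : Finset ι) (y : ι → ℝ)
    (hy : ∀ i ∈ s, 0 < y i) (hinj : Set.InjOn y s) (P : ℝ[X]) (hP : P.Monic)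
    (hdeg : P.natDegree = #s)
    (hlt : ∀ u : ℝ,
      P.eval (-u ^ 2) / (Lagrange.nodal s fun i => y i ^ 2).eval (-u ^ 2) < 1) :
    0 < ∑ i ∈ s, Lagrange.nodalWeight s (fun i => y i ^ 2) i * P.eval (y i ^ 2) / y i := by
  set K : ι → ℝ := fun i => Lagrange.nodalWeight s (fun i => y i ^ 2) i * P.eval (y i ^ 2)
  have hinj' : Set.InjOn (fun i => y i ^ 2) s := fun i hi j hj h =>
    hinj hi hj ((pow_left_inj₀ (hy i hi).le (hy j hj).le two_ne_zero).1 h)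
  have hpos : ∀ u : ℝ, 0 < ∑ i ∈ s, K i * (y i ^ 2 + u ^ 2)⁻¹ := fun u => by
    have h := sum_nodalWeight_mul_eval_div s (fun i => y i ^ 2) hinj' P hP hdeg (-u ^ 2)
      fun i hi => by nlinarith [pow_pos (hy i hi) 2, sq_nonneg u]
    simp only [sub_neg_eq_add] at h
    simp only [K, ← div_eq_mul_inv]
    rw [h]
    linarith [hlt u]
  have hint : ∀ i ∈ s, MeasureTheory.Integrable fun u : ℝ => K i * (y i ^ 2 + u ^ 2)⁻¹ :=
    fun i hi => (integrable_inv_sq_add_sq (hy i hi)).const_mul _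
  have hI : ∫ u : ℝ, ∑ i ∈ s, K i * (y i ^ 2 + u ^ 2)⁻¹ = Real.pi * ∑ i ∈ s, K i / y i := by
    rw [MeasureTheory.integral_finsetSum _ hint, Finset.mul_sum]
    refine Finset.sum_congr rfl fun i hi => ?_
    rw [MeasureTheory.integral_const_mul, integral_univ_inv_sq_add_sq (hy i hi)]
    ring
  have hIpos : 0 < ∫ u : ℝ, ∑ i ∈ s, K i * (y i ^ 2 + u ^ 2)⁻¹ := by
    rw [MeasureTheory.integral_pos_iff_support_of_nonneg (fun u => (hpos u).le)
      (MeasureTheory.integrable_finsetSum _ hint)]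
    have hsupp : (Function.support fun u : ℝ => ∑ i ∈ s, K i * (y i ^ 2 + u ^ 2)⁻¹) = Set.univ :=
      Set.eq_univ_of_forall fun u => (hpos u).ne'
    rw [hsupp]
    simp
  rw [hI] at hIpos
  exact pos_of_mul_pos_right hIpos Real.pi_pos.le

lemma prod_range_add_mul_factorial (a n : ℕ) :
    (∏ j ∈ range n, ((a : ℝ) + 1 + j)) * (a.factorial : ℝ) = ((a + n).factorial : ℝ) := by
  induction n with
  | zero => simp
  | succ n ih =>
    rw [prod_range_succ, mul_right_comm, ih, ← add_assoc, Nat.factorial_succ]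
    push_cast
    ring

lemma prod_range_sub_mul_factorial (a n : ℕ) :
    (∏ j ∈ range n, ((a : ℝ) + n - j)) * (a.factorial : ℝ) = ((a + n).factorial : ℝ) := by
  rw [← prod_range_add_mul_factorial a n, ← prod_range_reflect]
  congr 1
  refine prod_congr rfl fun j hj => ?_
  have hj' := mem_range.1 hj
  rw [Nat.sub_sub, Nat.cast_sub (by omega)]
  push_cast
  ring

lemma prod_range_erase_sub (k n : ℕ) :
    ∏ j ∈ (range (k + 1 + n)).erase k, ((k : ℝ) - j)
      = (-1) ^ n * (k.factorial : ℝ) * (n.factorial : ℝ) := by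
  induction n with
  | zero =>
    have h := prod_range_sub_mul_factorial 0 k
    rw [add_zero, range_add_one, erase_insert notMem_range_self]
    simpa using h
  | succ n ih =>
    have hne : k + 1 + n ≠ k := by omega
    rw [← add_assoc, range_add_one, erase_insert_of_ne hne, prod_insert (by simp), ih,
      Nat.factorial_succ]
    push_cast
    ring

lemma prod_range_sq_sub_sq (m k : ℕ) :
    (∏ j ∈ range (m + 1), (((m + 1 + k : ℕ) : ℝ) ^ 2 - (j : ℝ) ^ 2)) * (k.factorial : ℝ)
      = (m + 1 + k : ℕ) * ((2 * m + 1 + k).factorial : ℝ) := by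
  have h1 := prod_range_sub_mul_factorial k (m + 1)
  have h2 := prod_range_add_mul_factorial (m + k) (m + 1)
  have h3 : ((k + (m + 1)).factorial : ℝ) = (m + 1 + k : ℕ) * ((m + k).factorial : ℝ) := by
    rw [show k + (m + 1) = (m + k) + 1 by ring, Nat.factorial_succ]
    push_cast
    ring
  have h4 : ((m + k + (m + 1)).factorial : ℝ) = ((2 * m + 1 + k).factorial : ℝ) := by
    congr 2
    ring
  have hf : ((m + k).factorial : ℝ) ≠ 0 := by positivity
  have hprod : ∏ j ∈ range (m + 1), (((m + 1 + k : ℕ) : ℝ) ^ 2 - (j : ℝ) ^ 2)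
      = (∏ j ∈ range (m + 1), ((k : ℝ) + (m + 1 : ℕ) - j))
        * ∏ j ∈ range (m + 1), (((m + k : ℕ) : ℝ) + 1 + j) := by
    rw [← prod_mul_distrib]
    refine prod_congr rfl fun j _ => ?_
    push_cast
    ring
  rw [hprod, ← h4, ← h2]
  rw [h3] at h1
  linear_combination (∏ j ∈ range (m + 1), (((m + k : ℕ) : ℝ) + 1 + j)) * h1

/-- The nodal weights at the nodes `(m + 1) ^ 2, …, (2 * m) ^ 2`, with `m = k + 1 + n`. -/
lemma nodalWeight_sq {m k n : ℕ} (h : m = k + 1 + n) :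
    Lagrange.nodalWeight (range m) (fun j => ((m + 1 + j : ℕ) : ℝ) ^ 2) k
      = (-1) ^ n * (2 * (m + 1 + k : ℕ)) * ((2 * m + 1 + k).factorial : ℝ)
        / ((k.factorial : ℝ) * (n.factorial : ℝ) * ((3 * m + 1 + k).factorial : ℝ)) := by
  have hk : k ∈ range m := mem_range.2 (by omega)
  have h1 := prod_range_erase_sub k n
  rw [← h] at h1
  have h2 := prod_range_add_mul_factorial (2 * m + 1 + k) m
  rw [← mul_prod_erase _ _ hk, show 2 * m + 1 + k + m = 3 * m + 1 + k by ring] at h2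
  have hprod : ∏ j ∈ (range m).erase k,
        (((m + 1 + k : ℕ) : ℝ) ^ 2 - ((m + 1 + j : ℕ) : ℝ) ^ 2)
      = (∏ j ∈ (range m).erase k, ((k : ℝ) - j))
        * ∏ j ∈ (range m).erase k, (((2 * m + 1 + k : ℕ) : ℝ) + 1 + j) := by
    rw [← prod_mul_distrib]
    refine prod_congr rfl fun j _ => ?_
    push_cast
    ring
  rw [Lagrange.nodalWeight, prod_inv_distrib, hprod, h1, ← h2]
  have hQ : ∏ j ∈ (range m).erase k, (((2 * m + 1 + k : ℕ) : ℝ) + 1 + j) ≠ 0 :=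
    (prod_pos fun j _ => by positivity).ne'
  have hs : ((-1 : ℝ) ^ n) * (-1) ^ n = 1 := by rw [← mul_pow]; simp
  have hy' : ((2 * m + 1 + k : ℕ) : ℝ) + 1 + k = 2 * (m + 1 + k : ℕ) := by push_cast; ring
  rw [← hy']
  rw [inv_eq_iff_eq_inv, inv_div, eq_div_iff (by positivity)]
  linear_combination (k.factorial * n.factorial *
    (∏ j ∈ (range m).erase k, (((2 * m + 1 + k : ℕ) : ℝ) + 1 + j)) *
    (((2 * m + 1 + k : ℕ) : ℝ) + 1 + k) * (2 * m + 1 + k).factorial) * hs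

open Polynomial in
/-- `s(t) < 0` at every integer `0 ≤ t ≤ m`. -/
lemma sfun_natCast_neg {m t : ℕ} (hm : 1 ≤ m) (ht : t ≤ m) : sfun m t < 0 := by
  set J : Finset ℕ := (range (m + 1)).erase (m - t) with hJ
  have hmem : m - t ∈ range (m + 1) := mem_range.2 (by omega)
  have hJcard : #J = m := by rw [hJ, card_erase_of_mem hmem, card_range]; rfl
  set P : ℝ[X] := ∏ j ∈ J, (X - C ((j : ℝ) ^ 2))
  set y : ℕ → ℝ := fun k => ((m + 1 + k : ℕ) : ℝ)
  have hpos : 0 < ∑ k ∈ range m,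
      Lagrange.nodalWeight (range m) (fun i => y i ^ 2) k * P.eval (y k ^ 2) / y k := by
    refine sum_nodalWeight_mul_eval_div_pos (range m) y (fun k _ => by positivity)
      (fun i _ j _ h => by simpa [y] using h) P (monic_prod_X_sub_C _ _) ?_ fun u => ?_
    · rw [natDegree_finsetProd_X_sub_C_eq_card, hJcard, card_range]
    · have hnum : P.eval (-u ^ 2) = (-1) ^ m * ∏ j ∈ J, (u ^ 2 + (j : ℝ) ^ 2) := by
        rw [eval_prod, ← hJcard, ← prod_const, ← prod_mul_distrib]
        refine prod_congr rfl fun j _ => ?_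
        simp only [eval_sub, eval_X, eval_C]
        ring
      have hden : (Lagrange.nodal (range m) fun i => y i ^ 2).eval (-u ^ 2)
          = (-1) ^ m * ∏ k ∈ range m, (u ^ 2 + y k ^ 2) := by
        conv_rhs => rw [← card_range m, ← prod_const, card_range, ← prod_mul_distrib]
        rw [Lagrange.eval_nodal]
        exact prod_congr rfl fun j _ => by ring
      rw [hnum, hden, mul_div_mul_left _ _ (by simp),
        div_lt_one (prod_pos fun k _ => by positivity)]
      calc ∏ j ∈ J, (u ^ 2 + (j : ℝ) ^ 2) ≤ ∏ j ∈ J, (u ^ 2 + (m : ℝ) ^ 2) := by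
            refine prod_le_prod (fun j _ => by positivity) fun j hj => ?_
            have : j ≤ m := Nat.lt_succ_iff.1 (mem_range.1 (mem_of_mem_erase hj))
            gcongr
        _ = ∏ k ∈ range m, (u ^ 2 + (m : ℝ) ^ 2) := by
            rw [prod_const, prod_const, hJcard, card_range]
        _ < ∏ k ∈ range m, (u ^ 2 + y k ^ 2) := by
            have hm' : (0 : ℝ) < m := by exact_mod_cast hm
            refine prod_lt_prod_of_nonempty (fun k _ => by positivity) (fun k _ => ?_)
              (nonempty_range_iff.2 (by omega))
            have : (m : ℝ) < y k := by simp only [y]; exact_mod_cast (by omega)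
            gcongr
  have hterm : sfun m t = (1 / (Nat.factorial (2 * m + 1) : ℝ)) * -∑ k ∈ range m,
      Lagrange.nodalWeight (range m) (fun i => y i ^ 2) k * P.eval (y k ^ 2) / y k := by
    rw [sfun, ← Finset.sum_neg_distrib]
    congr 1
    have hIcc : Icc (2 * m + 1) (3 * m) = Ico (2 * m + 1) (3 * m + 1) := by
      ext i
      simp only [mem_Icc, mem_Ico]
      omega
    rw [hIcc, sum_Ico_eq_sum_range, show 3 * m + 1 - (2 * m + 1) = m by omega]
    refine sum_congr rfl fun k hk => ?_
    obtain ⟨n, hn⟩ : ∃ n, m = k + 1 + n := ⟨m - (k + 1), by have := mem_range.1 hk; omega⟩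
    have hP := prod_range_sq_sub_sq m k
    rw [← mul_prod_erase _ _ hmem] at hP
    have hPe : P.eval (y k ^ 2) = ∏ j ∈ J, (((m + 1 + k : ℕ) : ℝ) ^ 2 - (j : ℝ) ^ 2) := by
      simp [P, y, eval_prod]
    rw [← hJ, ← hPe, Nat.cast_sub ht] at hP
    rw [nodalWeight_sq hn]
    have e1 : 2 * m + 1 + k - (2 * m + 1) = k := by omega
    have e2 : 3 * m - (2 * m + 1 + k) = n := by omega
    have e3 : 2 * m + 1 + k + m = 3 * m + 1 + k := by ring
    have e4 : (-1 : ℝ) ^ (3 * m + 1 + k) = (-1) ^ n := by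
      rw [show 3 * m + 1 + k = n + 2 * (m + k + 1) by omega, pow_add, pow_mul]
      simp
    rw [e1, e2, e3, e4]
    have htm : (t : ℝ) ≤ m := by exact_mod_cast ht
    have hk0 : (0 : ℝ) ≤ k := k.cast_nonneg
    have ht0 : (0 : ℝ) ≤ t := t.cast_nonneg
    have ha : (t : ℝ) - (2 * m + 1 + k : ℕ) ≠ 0 := by push_cast; linarith
    have hb : (t : ℝ) - 2 * m + (2 * m + 1 + k : ℕ) ≠ 0 := by push_cast; linarith
    have hy : y k ≠ 0 := by positivity
    have hfac : ((m + 1 + k : ℕ) : ℝ) ^ 2 - ((m : ℝ) - t) ^ 2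
        = -(((t : ℝ) - (2 * m + 1 + k : ℕ)) * ((t : ℝ) - 2 * m + (2 * m + 1 + k : ℕ))) := by
      push_cast
      ring
    have hdiff : 1 / ((t : ℝ) - (2 * m + 1 + k : ℕ))
          - 1 / ((t : ℝ) - 2 * m + (2 * m + 1 + k : ℕ))
        = 2 * y k / (((t : ℝ) - (2 * m + 1 + k : ℕ))
          * ((t : ℝ) - 2 * m + (2 * m + 1 + k : ℕ))) := by
      rw [div_sub_div _ _ ha hb]
      congr 1
      simp only [y]
      push_cast
      ring
    have hPv : P.eval (y k ^ 2) = -(y k * ((2 * m + 1 + k).factorial : ℝ))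
        / ((((t : ℝ) - (2 * m + 1 + k : ℕ)) * ((t : ℝ) - 2 * m + (2 * m + 1 + k : ℕ)))
          * (k.factorial : ℝ)) := by
      rw [hfac] at hP
      rw [eq_div_iff (mul_ne_zero (mul_ne_zero ha hb) (by positivity))]
      simp only [y]
      linear_combination -hP
    rw [hdiff, hPv]
    change _ = -((-1) ^ n * (2 * y k) * _ / _ * _ / _)
    field_simp
  rw [hterm]
  exact mul_neg_of_pos_of_neg (by positivity) (neg_neg_of_pos hpos)

/-- `s(0) < 0` and `s(1) < 0`. -/
theorem stmt_4 (m : ℕ) (hm : 1 ≤ m) : sfun m 0 < 0 ∧ sfun m 1 < 0 :=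
  ⟨by simpa using sfun_natCast_neg hm m.zero_le, by simpa using sfun_natCast_neg hm hm⟩
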